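/- If f ∈ M(δ) with π/2 ≤ δ < π, then f(z)/z is subordinate to exp(B̃_δ(z)) on the unit disc, where B̃_δ(z) = ∫₀^z B_δ(t)/t dt. -/

import Mathlib

open Complex Metric

noncomputable def Bdelta (δ : ℝ) (z : ℂ) : ℂ :=
  (1 / (2 * Complex.I * Real.sin δ)) *
    Complex.log ((1 + z * Complex.exp (Complex.I * δ)) /
      (1 + z * Complex.exp (-Complex.I * δ)))

noncomputable def Btilde (δ : ℝ) (z : ℂ) : ℂ :=
  ∫ t in (0 : ℝ)..1, Bdelta δ ((t : ℂ) * z) / ((t : ℂ) * z) * z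

def Subord (g h : ℂ → ℂ) : Prop :=
  ∃ ω : ℂ → ℂ, DifferentiableOn ℂ ω (ball 0 1) ∧ ω 0 = 0 ∧
    (∀ z ∈ ball (0 : ℂ) 1, ω z ∈ ball (0 : ℂ) 1) ∧
    ∀ z ∈ ball (0 : ℂ) 1, g z = h (ω z)

/-- **Jack's lemma**. -/
theorem exists_one_le_mul_of_isMaxOn_norm {ω : ℂ → ℂ} {r : ℝ} (hr : 0 < r)
    (hd : ∀ z ∈ closedBall (0 : ℂ) r, DifferentiableAt ℂ ω z) (h0 : ω 0 = 0) {z₀ : ℂ}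
    (hz₀ : ‖z₀‖ = r) (hmax : ∀ z ∈ closedBall (0 : ℂ) r, ‖ω z‖ ≤ ‖ω z₀‖) (hne : ω z₀ ≠ 0) :
    ∃ m : ℝ, 1 ≤ m ∧ z₀ * deriv ω z₀ = m * ω z₀ := by
  have hmem : ∀ ζ : ℂ, ‖ζ‖ ≤ 1 → z₀ * ζ ∈ closedBall (0 : ℂ) r := fun ζ hζ => by
    rw [mem_closedBall_zero_iff, norm_mul, hz₀]
    exact mul_le_of_le_one_right hr.le hζ
  set u : ℂ → ℂ := fun ζ => ω (z₀ * ζ) / ω z₀ with hu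
  set c : ℂ := deriv ω z₀ * z₀ / ω z₀ with hc
  have hu1 : u 1 = 1 := by simp [hu, hne]
  have hule : ∀ ζ : ℂ, ‖ζ‖ ≤ 1 → ‖u ζ‖ ≤ 1 := fun ζ hζ => by
    rw [hu, norm_div]
    exact div_le_one_of_le₀ (hmax _ (hmem ζ hζ)) (norm_nonneg _)
  have hud : HasDerivAt u c 1 := by
    have h1 : HasDerivAt (fun ζ : ℂ => z₀ * ζ) z₀ 1 := by
      simpa using (hasDerivAt_id (1 : ℂ)).const_mul z₀
    have h2 : HasDerivAt ω (deriv ω z₀) (z₀ * 1) := by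
      rw [mul_one]
      exact (hd z₀ (by simp [hz₀])).hasDerivAt
    exact (h2.comp 1 h1).div_const _
  have hudiff : DifferentiableOn ℂ u (ball 0 1) := fun ζ hζ =>
    (((hd _ (hmem ζ (mem_ball_zero_iff.1 hζ).le)).comp ζ
      (differentiableAt_id.const_mul z₀)).div_const _).differentiableWithinAt
  have hschwarz : ∀ ζ : ℂ, ‖ζ‖ < 1 → ‖u ζ‖ ≤ ‖ζ‖ := fun ζ hζ =>
    norm_le_norm_of_mapsTo_ball hudiff
      (fun x hx => mem_closedBall_zero_iff.2 (hule x (mem_ball_zero_iff.1 hx).le))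
      (by simp [hu, h0]) hζ
  have him : c.im = 0 := by
    have h1 : HasDerivAt (fun θ : ℝ => exp ((θ : ℂ) * I)) I 0 := by
      have : HasDerivAt (fun θ : ℝ => (θ : ℂ) * I) (1 * I) 0 :=
        (HasDerivAt.ofReal_comp (hasDerivAt_id (0 : ℝ))).mul_const I
      simpa using this.cexp
    have h2 : HasDerivAt (fun θ : ℝ => u (exp ((θ : ℂ) * I))) (c * I) 0 :=
      HasDerivAt.comp (0 : ℝ) (h₂ := u) (by simpa using hud) h1
    have h3 : HasDerivAt (fun θ : ℝ => (u (exp ((θ : ℂ) * I))).re) (c * I).re 0 :=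
      reCLM.hasFDerivAt.comp_hasDerivAt (0 : ℝ) h2
    have h4 : IsLocalMax (fun θ : ℝ => (u (exp ((θ : ℂ) * I))).re) 0 :=
      Filter.Eventually.of_forall fun θ => by
        simpa [hu1] using (re_le_norm _).trans (hule _ (norm_exp_ofReal_mul_I θ).le)
    simpa using h4.hasDerivAt_eq_zero h3
  have hre : 1 ≤ c.re := by
    have h1 : HasDerivAt (fun t : ℝ => u (t : ℂ)) c 1 := by
      have h : HasDerivAt u c ((1 : ℝ) : ℂ) := by simpa using hud
      exact h.comp_ofReal
    have h2 : HasDerivAt (fun t : ℝ => (u (t : ℂ)).re) c.re 1 :=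
      reCLM.hasFDerivAt.comp_hasDerivAt (1 : ℝ) h1
    have h3 := h2.tendsto_slope.mono_left (nhdsWithin_mono (1 : ℝ)
      (show Set.Iio (1 : ℝ) ⊆ {1}ᶜ from fun x (hx : x < 1) => hx.ne))
    refine ge_of_tendsto h3 ?_
    filter_upwards [Ioo_mem_nhdsLT (zero_lt_one' ℝ)] with t ht
    rw [slope_comm, slope_def_field, le_div_iff₀ (by linarith [ht.2])]
    have := (re_le_norm _).trans (hschwarz (t : ℂ) (by simpa [abs_of_pos ht.1] using ht.2))
    simp only [norm_real, Real.norm_eq_abs, abs_of_pos ht.1] at this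
    simp only [ofReal_one, hu1, one_re]
    linarith
  refine ⟨c.re, hre, ?_⟩
  have : (c.re : ℂ) = c := Complex.ext rfl (by simp [him])
  rw [this, hc]
  field_simp

theorem map_nhds_eq_of_hasDerivAt_ball {H H' : ℂ → ℂ}
    (hH : ∀ z ∈ ball (0 : ℂ) 1, HasDerivAt H (H' z) z) {x : ℂ} (hx : x ∈ ball (0 : ℂ) 1)
    (hx' : H' x ≠ 0) : Filter.map H (nhds x) = nhds (H x) := by
  have han : AnalyticAt ℂ H x :=
    DifferentiableOn.analyticAt (s := ball 0 1)
      (fun z hz => (hH z hz).differentiableAt.differentiableWithinAt) (isOpen_ball.mem_nhds hx)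
  have hstrict := han.hasStrictDerivAt
  rw [(hH x hx).deriv] at hstrict
  exact hstrict.map_nhds_eq hx'

theorem hasDerivAt_invFunOn_ball {H H' : ℂ → ℂ} (hH : ∀ z ∈ ball (0 : ℂ) 1, HasDerivAt H (H' z) z)
    (hH' : ∀ z ∈ ball (0 : ℂ) 1, H' z ≠ 0) (hinj : Set.InjOn H (ball 0 1)) {x : ℂ}
    (hx : x ∈ ball (0 : ℂ) 1) :
    HasDerivAt (Function.invFunOn H (ball 0 1)) (H' x)⁻¹ (H x) := by
  have hleft : ∀ y ∈ ball (0 : ℂ) 1, Function.invFunOn H (ball 0 1) (H y) = y :=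
    fun y hy => hinj.leftInvOn_invFunOn hy
  have hmap := map_nhds_eq_of_hasDerivAt_ball hH hx (hH' x hx)
  refine HasDerivAt.of_local_left_inverse (f := H) ?_ (by rw [hleft x hx]; exact hH x hx)
    (hH' x hx) ?_
  · rw [ContinuousAt, ← hmap, Filter.tendsto_map'_iff, hleft x hx]
    refine Filter.Tendsto.congr' ?_ Filter.tendsto_id
    filter_upwards [isOpen_ball.mem_nhds hx] with y hy using (hleft y hy).symm
  · rw [← hmap, Filter.eventually_map]
    filter_upwards [isOpen_ball.mem_nhds hx] with y hy
    rw [hleft y hy]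

/-- **Suffridge's theorem**: if `z * G' z` is subordinate to the starlike function
`h z = z * H' z`, then `G` is subordinate to `H`. -/
theorem subord_of_mul_deriv_eq_comp {H H' h G G' w : ℂ → ℂ}
    (hH : ∀ z ∈ ball (0 : ℂ) 1, HasDerivAt H (H' z) z) (hH0 : H 0 = 0)
    (hH' : ∀ z ∈ ball (0 : ℂ) 1, H' z ≠ 0) (hinj : Set.InjOn H (ball 0 1))
    (hh : ∀ z ∈ ball (0 : ℂ) 1, z * H' z = h z)
    (hstar : ∀ a ∈ ball (0 : ℂ) 1, ∀ b ∈ ball (0 : ℂ) 1, ∀ m : ℝ, 1 ≤ m → h a = m * h b →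
      ‖b‖ ≤ ‖a‖)
    (hG : ∀ z ∈ ball (0 : ℂ) 1, HasDerivAt G (G' z) z) (hG0 : G 0 = 0)
    (hw : ∀ z ∈ ball (0 : ℂ) 1, ‖w z‖ ≤ ‖z‖)
    (hGw : ∀ z ∈ ball (0 : ℂ) 1, z * G' z = h (w z)) : Subord G H := by
  set Ψ := Function.invFunOn H (ball (0 : ℂ) 1) with hΨ
  set U := H '' ball (0 : ℂ) 1 with hU
  have h0mem : (0 : ℂ) ∈ ball (0 : ℂ) 1 := mem_ball_self one_pos
  have hΨmem : ∀ y ∈ U, Ψ y ∈ ball (0 : ℂ) 1 := fun y hy => Function.invFunOn_mem hy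
  have hΨeq : ∀ y ∈ U, H (Ψ y) = y := fun y hy => Function.invFunOn_eq hy
  have hΨ0 : Ψ 0 = 0 := by
    rw [← hH0]
    exact (hinj.leftInvOn_invFunOn h0mem).trans hH0.symm
  have hΨd : ∀ y ∈ U, HasDerivAt Ψ (H' (Ψ y))⁻¹ y := fun y hy => by
    have := hasDerivAt_invFunOn_ball hH hH' hinj (hΨmem y hy)
    rwa [hΨeq y hy] at this
  have hUopen : IsOpen U := isOpen_iff_mem_nhds.2 fun y hy => by
    obtain ⟨x, hx, rfl⟩ := hy
    rw [← map_nhds_eq_of_hasDerivAt_ball hH hx (hH' x hx)]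
    exact Filter.image_mem_map (isOpen_ball.mem_nhds hx)
  have hωd : ∀ z ∈ ball (0 : ℂ) 1, G z ∈ U →
      HasDerivAt (fun z => Ψ (G z)) ((H' (Ψ (G z)))⁻¹ * G' z) z := fun z hz hGz =>
    (hΨd _ hGz).comp z (hG z hz)
  have apriori : ∀ r < 1, (∀ z ∈ closedBall (0 : ℂ) r, G z ∈ U) →
      ∀ z ∈ closedBall (0 : ℂ) r, ‖Ψ (G z)‖ ≤ r := by
    intro r hr1 hr z hz
    have hsub : closedBall (0 : ℂ) r ⊆ ball 0 1 := closedBall_subset_ball hr1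
    obtain hr0 | hr0 := (nonempty_closedBall.1 ⟨z, hz⟩).eq_or_lt
    · subst hr0
      have : z = 0 := by simpa using hz
      simp [this, hG0, hΨ0]
    have hd : ∀ z ∈ closedBall (0 : ℂ) r, DifferentiableAt ℂ (fun z => Ψ (G z)) z :=
      fun z hz => (hωd z (hsub hz) (hr z hz)).differentiableAt
    obtain ⟨z₀, hz₀, hmax⟩ := exists_mem_frontier_isMaxOn_norm (f := fun z => Ψ (G z))
      (isBounded_ball (x := (0 : ℂ)) (r := r)) ⟨0, mem_ball_self hr0⟩
      (DifferentiableOn.diffContOnCl fun z hz =>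
        (hd z (closure_ball_subset_closedBall hz)).differentiableWithinAt)
    rw [closure_ball _ hr0.ne'] at hmax
    rw [frontier_ball _ hr0.ne', mem_sphere_zero_iff_norm] at hz₀
    have hz₀' : z₀ ∈ closedBall (0 : ℂ) r := by simp [hz₀]
    refine (hmax hz).trans ?_
    change ‖Ψ (G z₀)‖ ≤ r
    by_cases hne : Ψ (G z₀) = 0
    · simpa [hne] using hr0.le
    obtain ⟨m, hm, hmeq⟩ := exists_one_le_mul_of_isMaxOn_norm hr0 hd (by simp [hG0, hΨ0]) hz₀
      (fun z hz => hmax hz) hne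
    rw [(hωd z₀ (hsub hz₀') (hr _ hz₀')).deriv] at hmeq
    have hmem := hΨmem _ (hr _ hz₀')
    have hwle := hw z₀ (hsub hz₀')
    rw [← hz₀]
    refine (hstar (w z₀) ?_ _ hmem m hm ?_).trans hwle
    · rw [mem_ball_zero_iff]
      exact hwle.trans_lt (hz₀ ▸ hr1)
    · rw [← hGw z₀ (hsub hz₀'), ← hh _ hmem]
      have := hH' _ hmem
      field_simp at hmeq
      linear_combination hmeq
  have hmaps : ∀ z ∈ ball (0 : ℂ) 1, G z ∈ U := by
    by_contra! hcon
    obtain ⟨z₁, hz₁, hGz₁⟩ := hcon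
    have hGcont : ContinuousOn G (closedBall 0 ‖z₁‖) := fun z hz =>
      (hG z (closedBall_subset_ball (mem_ball_zero_iff.1 hz₁) hz)).continuousAt.continuousWithinAt
    have hK : IsCompact (closedBall (0 : ℂ) ‖z₁‖ ∩ G ⁻¹' Uᶜ) :=
      (isCompact_closedBall _ _).of_isClosed_subset
        (hGcont.preimage_isClosed_of_isClosed isClosed_closedBall hUopen.isClosed_compl)
        Set.inter_subset_left
    obtain ⟨z₂, ⟨hz₂, hGz₂⟩, hmin⟩ := hK.exists_isMinOn ⟨z₁, by simp, hGz₁⟩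
      continuous_norm.continuousOn
    have hz₂1 : ‖z₂‖ < 1 := (mem_closedBall_zero_iff.1 hz₂).trans_lt (mem_ball_zero_iff.1 hz₁)
    have hin : ∀ z : ℂ, ‖z‖ < ‖z₂‖ → G z ∈ U := fun z hz => by
      by_contra hGz
      exact absurd (hmin (a := z) ⟨by
        rw [mem_closedBall_zero_iff]
        exact hz.le.trans (mem_closedBall_zero_iff.1 hz₂), hGz⟩) (not_le.2 hz)
    have hcpt : IsCompact (H '' closedBall 0 ‖z₂‖) :=
      (isCompact_closedBall _ _).image_of_continuousOn fun z hz =>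
        (hH z (closedBall_subset_ball hz₂1 hz)).continuousAt.continuousWithinAt
    refine hGz₂ (Set.image_mono (closedBall_subset_ball hz₂1) (?_ : G z₂ ∈ H '' closedBall 0 ‖z₂‖))
    have hne : z₂ ≠ 0 := by
      rintro rfl
      exact hGz₂ ⟨0, h0mem, by rw [hH0, hG0]⟩
    have hcl : z₂ ∈ closure (ball (0 : ℂ) ‖z₂‖) := by
      rw [closure_ball _ (norm_ne_zero_iff.2 hne)]
      simp
    have hmapsTo : Set.MapsTo G (ball 0 ‖z₂‖) (H '' closedBall 0 ‖z₂‖) := fun z hz => by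
      rw [mem_ball_zero_iff] at hz
      refine ⟨Ψ (G z), ?_, hΨeq _ (hin z hz)⟩
      rw [mem_closedBall_zero_iff]
      exact (apriori ‖z‖ (hz.trans hz₂1) (fun x hx => hin x
        ((mem_closedBall_zero_iff.1 hx).trans_lt hz)) z (by simp)).trans hz.le
    have := hmapsTo.closure_of_continuousOn (f := G) (fun z hz => (hG z
      (closedBall_subset_ball hz₂1 (closure_ball_subset_closedBall hz))).continuousAt.continuousWithinAt) hcl
    rwa [hcpt.isClosed.closure_eq] at this
  exact ⟨fun z => Ψ (G z),
    fun z hz => (hωd z hz (hmaps z hz)).differentiableAt.differentiableWithinAt,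
    by simp [hG0, hΨ0], fun z hz => hΨmem _ (hmaps z hz), fun z hz => (hΨeq _ (hmaps z hz)).symm⟩

theorem exp_I_mul_ofReal (δ : ℝ) : exp (I * δ) = ⟨Real.cos δ, Real.sin δ⟩ := by
  apply Complex.ext <;> simp [exp_re, exp_im]

theorem exp_neg_I_mul_ofReal (δ : ℝ) : exp (-I * δ) = ⟨Real.cos δ, -Real.sin δ⟩ := by
  apply Complex.ext <;> simp [exp_re, exp_im]

theorem exp_I_mul_sub_exp_neg_I_mul (δ : ℝ) :
    exp (I * δ) - exp (-I * δ) = 2 * I * Real.sin δ := by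
  rw [exp_I_mul_ofReal, exp_neg_I_mul_ofReal]
  apply Complex.ext <;> simp [-ofReal_sin]
  ring

theorem norm_exp_neg_I_mul_ofReal (δ : ℝ) : ‖exp (-I * δ)‖ = 1 := by
  simpa using Complex.norm_exp_I_mul_ofReal (-δ)

theorem one_add_mul_ne_zero {z c : ℂ} (hz : z ∈ ball (0 : ℂ) 1) (hc : ‖c‖ ≤ 1) :
    1 + z * c ≠ 0 := by
  intro h
  have h1 : ‖z * c‖ < 1 := by
    rw [norm_mul]
    exact (mul_le_of_le_one_right (norm_nonneg _) hc).trans_lt (mem_ball_zero_iff.1 hz)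
  rw [eq_neg_of_add_eq_zero_right h] at h1
  simp at h1

/-- The vertical strip onto which `Bdelta δ` maps the unit disc. -/
def deltaStrip (δ : ℝ) : Set ℂ :=
  {q | (δ - Real.pi) / (2 * Real.sin δ) < q.re ∧ q.re < δ / (2 * Real.sin δ)}

/-- The inverse of `Bdelta δ` on `deltaStrip δ`. -/
noncomputable def BdeltaInv (δ : ℝ) (q : ℂ) : ℂ :=
  (exp (2 * I * Real.sin δ * q) - 1) / (exp (I * δ) - exp (2 * I * Real.sin δ * q) * exp (-I * δ))

/-- The Möbius transformation whose logarithm defines `Bdelta δ`. -/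
noncomputable def mobiusDelta (δ : ℝ) (z : ℂ) : ℂ :=
  (1 + z * exp (I * δ)) / (1 + z * exp (-I * δ))

theorem Bdelta_eq_log_mobiusDelta (δ : ℝ) (z : ℂ) :
    Bdelta δ z = 1 / (2 * I * Real.sin δ) * log (mobiusDelta δ z) := rfl

theorem Bdelta_zero (δ : ℝ) : Bdelta δ 0 = 0 := by simp [Bdelta]

theorem two_I_sin_ne_zero {δ : ℝ} (hδ0 : 0 < δ) (hδ2 : δ < Real.pi) :
    (2 * I * Real.sin δ : ℂ) ≠ 0 :=
  mul_ne_zero (by simp) (ofReal_ne_zero.2 (Real.sin_pos_of_pos_of_lt_pi hδ0 hδ2).ne')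

theorem mobiusDelta_mul_exp_im_neg {δ : ℝ} (hδ0 : 0 < δ) (hδ2 : δ < Real.pi) {z : ℂ}
    (hz : z ∈ ball (0 : ℂ) 1) : (mobiusDelta δ z * exp (-I * δ)).im < 0 := by
  have hs := Real.sin_pos_of_pos_of_lt_pi hδ0 hδ2
  have hne := one_add_mul_ne_zero hz (norm_exp_neg_I_mul_ofReal δ).le
  have hz1 : z.re ^ 2 + z.im ^ 2 < 1 := by
    have h := mem_ball_zero_iff.1 hz
    have : ‖z‖ ^ 2 < 1 := by nlinarith [norm_nonneg z]
    rw [← normSq_eq_norm_sq, normSq_apply] at this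
    linarith
  have hsc := Real.sin_sq_add_cos_sq δ
  rw [mobiusDelta, div_mul_eq_mul_div, div_im, ← sub_div]
  refine div_neg_of_neg_of_pos ?_ (normSq_pos.2 hne)
  rw [exp_I_mul_ofReal, exp_neg_I_mul_ofReal]
  simp only [mul_re, mul_im, add_re, add_im, one_re, one_im]
  have : Real.sin δ * (z.re ^ 2 + z.im ^ 2 - 1) < 0 := mul_neg_of_pos_of_neg hs (by linarith)
  linear_combination this + (Real.sin δ * (z.re ^ 2 + z.im ^ 2)) * hsc

theorem mobiusDelta_mem_slitPlane {δ : ℝ} (hδ0 : 0 < δ) (hδ2 : δ < Real.pi) {z : ℂ}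
    (hz : z ∈ ball (0 : ℂ) 1) : mobiusDelta δ z ∈ slitPlane := by
  have hs := Real.sin_pos_of_pos_of_lt_pi hδ0 hδ2
  have h := mobiusDelta_mul_exp_im_neg hδ0 hδ2 hz
  rw [exp_neg_I_mul_ofReal, mul_im] at h
  rw [mem_slitPlane_iff]
  by_contra! hcon
  rw [hcon.2] at h
  simp only at h
  nlinarith [hcon.1]

theorem exp_two_I_sin_mul_Bdelta {δ : ℝ} (hδ0 : 0 < δ) (hδ2 : δ < Real.pi) {z : ℂ}
    (hz : z ∈ ball (0 : ℂ) 1) : exp (2 * I * Real.sin δ * Bdelta δ z) = mobiusDelta δ z := by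
  rw [Bdelta_eq_log_mobiusDelta, ← mul_assoc,
    mul_one_div_cancel (two_I_sin_ne_zero hδ0 hδ2), one_mul,
    exp_log (slitPlane_ne_zero (mobiusDelta_mem_slitPlane hδ0 hδ2 hz))]

theorem Bdelta_mem_deltaStrip {δ : ℝ} (hδ0 : 0 < δ) (hδ2 : δ < Real.pi) {z : ℂ}
    (hz : z ∈ ball (0 : ℂ) 1) : Bdelta δ z ∈ deltaStrip δ := by
  have hs := Real.sin_pos_of_pos_of_lt_pi hδ0 hδ2
  have h := mobiusDelta_mul_exp_im_neg hδ0 hδ2 hz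
  have hne := slitPlane_ne_zero (mobiusDelta_mem_slitPlane hδ0 hδ2 hz)
  set Q := mobiusDelta δ z with hQ
  have hre : (Bdelta δ z).re = Q.arg / (2 * Real.sin δ) := by
    have : Bdelta δ z = -I * log Q / (2 * Real.sin δ : ℝ) := by
      rw [Bdelta_eq_log_mobiusDelta, ← hQ]
      have : (Real.sin δ : ℂ) ≠ 0 := ofReal_ne_zero.2 hs.ne'
      rw [ofReal_mul, ofReal_ofNat]
      field_simp
      simp
    rw [this, div_ofReal_re]
    simp [log_im]
  have hsin : Real.sin (Q.arg - δ) < 0 := by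
    have : (Q * exp (-I * δ)).im = ‖Q‖ * Real.sin (Q.arg - δ) := by
      rw [exp_neg_I_mul_ofReal, mul_im, Real.sin_sub, mul_sub, ← mul_assoc, ← mul_assoc,
        norm_mul_sin_arg, norm_mul_cos_arg]
      ring
    rw [this] at h
    exact neg_of_mul_neg_right h (norm_nonneg _)
  have h1 := arg_le_pi Q
  have h2 := neg_pi_lt_arg Q
  rw [deltaStrip, Set.mem_ofPred_eq, hre, div_lt_div_iff_of_pos_right (by positivity),
    div_lt_div_iff_of_pos_right (by positivity)]
  constructor
  · by_contra! hcon
    have : 0 ≤ Real.sin (Q.arg - δ + 2 * Real.pi) :=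
      Real.sin_nonneg_of_nonneg_of_le_pi (by linarith) (by linarith)
    rw [Real.sin_add_two_pi] at this
    linarith
  · by_contra! hcon
    have : 0 ≤ Real.sin (Q.arg - δ) :=
      Real.sin_nonneg_of_nonneg_of_le_pi (by linarith) (by linarith)
    linarith

theorem two_sin_mul_re_mem_Ioo {δ : ℝ} (hδ0 : 0 < δ) (hδ2 : δ < Real.pi) {q : ℂ}
    (hq : q ∈ deltaStrip δ) :
    δ - Real.pi < (2 * I * Real.sin δ * q).im ∧ (2 * I * Real.sin δ * q).im < δ := by
  have hs := Real.sin_pos_of_pos_of_lt_pi hδ0 hδ2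
  have : (2 * I * Real.sin δ * q).im = q.re * (2 * Real.sin δ) := by
    simp [mul_im, mul_re, -ofReal_sin]
    ring
  rw [this, ← div_lt_iff₀ (by positivity), ← lt_div_iff₀ (by positivity)]
  exact hq

theorem exp_mul_exp_im_neg {δ : ℝ} (hδ0 : 0 < δ) (hδ2 : δ < Real.pi) {q : ℂ}
    (hq : q ∈ deltaStrip δ) : (exp (2 * I * Real.sin δ * q) * exp (-I * δ)).im < 0 := by
  obtain ⟨h1, h2⟩ := two_sin_mul_re_mem_Ioo hδ0 hδ2 hq
  rw [← Complex.exp_add, exp_im]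
  refine mul_neg_of_pos_of_neg (Real.exp_pos _) (Real.sin_neg_of_neg_of_neg_pi_lt ?_ ?_)
  · simp only [add_im, neg_mul, neg_im, I_mul_im, ofReal_re]
    linarith
  · simp only [add_im, neg_mul, neg_im, I_mul_im, ofReal_re]
    linarith

theorem BdeltaInv_denom_ne_zero {δ : ℝ} (hδ0 : 0 < δ) (hδ2 : δ < Real.pi) {q : ℂ}
    (hq : q ∈ deltaStrip δ) :
    exp (I * δ) - exp (2 * I * Real.sin δ * q) * exp (-I * δ) ≠ 0 := by
  intro h
  have h1 := congrArg im h
  have h2 := exp_mul_exp_im_neg hδ0 hδ2 hq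
  have hs := Real.sin_pos_of_pos_of_lt_pi hδ0 hδ2
  rw [sub_im, exp_I_mul_ofReal, zero_im] at h1
  simp only at h1
  linarith

theorem BdeltaInv_mem_ball {δ : ℝ} (hδ0 : 0 < δ) (hδ2 : δ < Real.pi) {q : ℂ}
    (hq : q ∈ deltaStrip δ) : BdeltaInv δ q ∈ ball (0 : ℂ) 1 := by
  have h2 := exp_mul_exp_im_neg hδ0 hδ2 hq
  have hs := Real.sin_pos_of_pos_of_lt_pi hδ0 hδ2
  rw [mem_ball_zero_iff, BdeltaInv, norm_div,
    div_lt_one (norm_pos_iff.2 (BdeltaInv_denom_ne_zero hδ0 hδ2 hq))]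
  refine lt_of_pow_lt_pow_left₀ 2 (norm_nonneg _) ?_
  rw [← normSq_eq_norm_sq, ← normSq_eq_norm_sq, normSq_apply, normSq_apply]
  generalize exp (2 * I * Real.sin δ * q) = E at *
  rw [exp_I_mul_ofReal, exp_neg_I_mul_ofReal]
  rw [exp_neg_I_mul_ofReal] at h2
  simp only [mul_re, mul_im, sub_re, sub_im, one_re, one_im] at *
  have hsc := Real.sin_sq_add_cos_sq δ
  have := mul_neg_of_pos_of_neg hs h2
  nlinarith

theorem Bdelta_BdeltaInv {δ : ℝ} (hδ0 : 0 < δ) (hδ2 : δ < Real.pi) {q : ℂ}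
    (hq : q ∈ deltaStrip δ) : Bdelta δ (BdeltaInv δ q) = q := by
  obtain ⟨h1, h2⟩ := two_sin_mul_re_mem_Ioo hδ0 hδ2 hq
  have hE : mobiusDelta δ (BdeltaInv δ q) = exp (2 * I * Real.sin δ * q) := by
    have hd := BdeltaInv_denom_ne_zero hδ0 hδ2 hq
    rw [mobiusDelta, div_eq_iff (one_add_mul_ne_zero (BdeltaInv_mem_ball hδ0 hδ2 hq)
      (norm_exp_neg_I_mul_ofReal δ).le), BdeltaInv]
    generalize exp (2 * I * Real.sin δ * q) = E at *
    generalize exp (I * δ) = α at *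
    generalize exp (-I * δ) = β at *
    field_simp
    ring
  rw [Bdelta_eq_log_mobiusDelta, hE, log_exp (by linarith) (by linarith),
    ← mul_assoc, one_div_mul_cancel (two_I_sin_ne_zero hδ0 hδ2), one_mul]

theorem BdeltaInv_Bdelta {δ : ℝ} (hδ0 : 0 < δ) (hδ2 : δ < Real.pi) {z : ℂ}
    (hz : z ∈ ball (0 : ℂ) 1) : BdeltaInv δ (Bdelta δ z) = z := by
  have hd := BdeltaInv_denom_ne_zero hδ0 hδ2 (Bdelta_mem_deltaStrip hδ0 hδ2 hz)
  have h1 := one_add_mul_ne_zero hz (norm_exp_neg_I_mul_ofReal δ).le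
  rw [BdeltaInv, div_eq_iff hd, exp_two_I_sin_mul_Bdelta hδ0 hδ2 hz, mobiusDelta]
  generalize exp (I * δ) = α at *
  generalize exp (-I * δ) = β at *
  field_simp
  ring

theorem zero_mem_deltaStrip {δ : ℝ} (hδ0 : 0 < δ) (hδ2 : δ < Real.pi) :
    (0 : ℂ) ∈ deltaStrip δ := by
  simpa [Bdelta_zero] using Bdelta_mem_deltaStrip hδ0 hδ2 (mem_ball_self one_pos)

theorem BdeltaInv_zero (δ : ℝ) : BdeltaInv δ 0 = 0 := by simp [BdeltaInv]

theorem differentiableAt_BdeltaInv {δ : ℝ} (hδ0 : 0 < δ) (hδ2 : δ < Real.pi) {q : ℂ}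
    (hq : q ∈ deltaStrip δ) : DifferentiableAt ℂ (BdeltaInv δ) q :=
  DifferentiableAt.div (by fun_prop) (by fun_prop) (BdeltaInv_denom_ne_zero hδ0 hδ2 hq)

theorem differentiableOn_Bdelta {δ : ℝ} (hδ0 : 0 < δ) (hδ2 : δ < Real.pi) :
    DifferentiableOn ℂ (Bdelta δ) (ball 0 1) := fun z hz => by
  have h1 := one_add_mul_ne_zero hz (norm_exp_neg_I_mul_ofReal δ).le
  have : DifferentiableAt ℂ (mobiusDelta δ) z :=
    DifferentiableAt.div (by fun_prop) (by fun_prop) h1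
  exact ((this.clog (mobiusDelta_mem_slitPlane hδ0 hδ2 hz)).const_mul _).differentiableWithinAt

/-- The strip is starlike about the origin, so Schwarz's lemma applies to
`z ↦ BdeltaInv δ (s * Bdelta δ z)` for `0 ≤ s ≤ 1`. -/
theorem norm_le_of_Bdelta_eq_mul {δ : ℝ} (hδ0 : 0 < δ) (hδ2 : δ < Real.pi) {a b : ℂ}
    (ha : a ∈ ball (0 : ℂ) 1) (hb : b ∈ ball (0 : ℂ) 1) {m : ℝ} (hm : 1 ≤ m)
    (h : Bdelta δ a = m * Bdelta δ b) : ‖b‖ ≤ ‖a‖ := by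
  have hm0 : 0 < m := one_pos.trans_le hm
  have hstrip : ∀ z ∈ ball (0 : ℂ) 1, (m⁻¹ : ℝ) * Bdelta δ z ∈ deltaStrip δ := fun z hz => by
    have h1 := Bdelta_mem_deltaStrip hδ0 hδ2 hz
    have h2 := zero_mem_deltaStrip hδ0 hδ2
    have h3 : m⁻¹ ≤ 1 := inv_le_one_of_one_le₀ hm
    have h4 : 0 < m⁻¹ := inv_pos.2 hm0
    simp only [deltaStrip, Set.mem_ofPred_eq, re_ofReal_mul, zero_re] at *
    constructor <;> nlinarith
  have hschwarz := norm_le_norm_of_mapsTo_ball (R := 1) (z := a)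
    (f := fun z => BdeltaInv δ ((m⁻¹ : ℝ) * Bdelta δ z))
    (fun z hz => (DifferentiableAt.comp z (differentiableAt_BdeltaInv hδ0 hδ2 (hstrip z hz))
      (((differentiableOn_Bdelta hδ0 hδ2).differentiableAt
        (isOpen_ball.mem_nhds hz)).const_mul _)).differentiableWithinAt)
    (fun z hz => ball_subset_closedBall (BdeltaInv_mem_ball hδ0 hδ2 (hstrip z hz)))
    (by simp [Bdelta_zero, BdeltaInv_zero]) (mem_ball_zero_iff.1 ha)
  have : ((m⁻¹ : ℝ) : ℂ) * Bdelta δ a = Bdelta δ b := by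
    rw [h, ← mul_assoc, ← ofReal_mul, inv_mul_cancel₀ hm0.ne', ofReal_one, one_mul]
  simpa only [this, BdeltaInv_Bdelta hδ0 hδ2 hb] using hschwarz

theorem half_le_re_inv_one_add {u : ℂ} (hu : ‖u‖ < 1) : 1 / 2 ≤ ((1 + u)⁻¹).re := by
  have h : u.re ^ 2 + u.im ^ 2 < 1 := by
    have : ‖u‖ ^ 2 < 1 := by nlinarith [norm_nonneg u]
    rw [← normSq_eq_norm_sq, normSq_apply] at this
    linarith
  have hne : 1 + u ≠ 0 := by
    intro h0
    rw [eq_neg_of_add_eq_zero_right h0] at hu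
    simp at hu
  rw [inv_re, le_div_iff₀ (normSq_pos.2 hne), normSq_apply]
  simp only [add_re, add_im, one_re, one_im]
  nlinarith

theorem half_le_re_Bdelta_div {δ : ℝ} (hδ0 : 0 < δ) (hδ2 : δ < Real.pi) {z : ℂ}
    (hz : z ∈ ball (0 : ℂ) 1) (hz0 : z ≠ 0) : 1 / 2 ≤ (Bdelta δ z / z).re := by
  set c : ℝ → ℂ := fun t => exp (-I * δ) + t * (exp (I * δ) - exp (-I * δ)) with hc
  have hcnorm : ∀ t ∈ Set.Icc (0 : ℝ) 1, ‖c t‖ ≤ 1 := fun t ht => by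
    have := (convex_closedBall (0 : ℂ) 1).add_smul_sub_mem (x := exp (-I * δ))
      (y := exp (I * δ))
      (mem_closedBall_zero_iff.2 (norm_exp_neg_I_mul_ofReal δ).le)
      (by simp [Complex.norm_exp_I_mul_ofReal]) ht
    simpa [hc] using this
  have hzc : ∀ t ∈ Set.Icc (0 : ℝ) 1, ‖z * c t‖ < 1 := fun t ht => by
    rw [norm_mul]
    exact (mul_le_of_le_one_right (norm_nonneg _) (hcnorm t ht)).trans_lt (mem_ball_zero_iff.1 hz)
  have hne : ∀ t ∈ Set.Icc (0 : ℝ) 1, 1 + z * c t ≠ 0 := fun t ht =>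
    one_add_mul_ne_zero hz (hcnorm t ht)
  have hint : Bdelta δ z / z = ∫ t in (0 : ℝ)..1, (1 + z * c t)⁻¹ := by
    have hQ := mobiusDelta_mem_slitPlane hδ0 hδ2 hz
    have hlog := log_eq_integral (z := mobiusDelta δ z - 1) (by simpa using hQ)
    rw [add_sub_cancel] at hlog
    rw [Bdelta_eq_log_mobiusDelta, hlog, ← mul_assoc, mul_div_right_comm,
      ← intervalIntegral.integral_const_mul]
    refine intervalIntegral.integral_congr fun t ht => ?_
    rw [Set.uIcc_of_le zero_le_one] at ht
    have h1 := hne t ht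
    have h2 := one_add_mul_ne_zero hz (norm_exp_neg_I_mul_ofReal δ).le
    have h3 := two_I_sin_ne_zero hδ0 hδ2
    have h4 : mobiusDelta δ z - 1 = z * (2 * I * Real.sin δ) / (1 + z * exp (-I * δ)) := by
      rw [← exp_I_mul_sub_exp_neg_I_mul, mobiusDelta, div_sub_one h2]
      ring
    have h5 : 1 + t • (mobiusDelta δ z - 1) = (1 + z * c t) / (1 + z * exp (-I * δ)) := by
      rw [h4, hc, real_smul, ← exp_I_mul_sub_exp_neg_I_mul, eq_div_iff h2, add_mul,
        mul_assoc (t : ℂ), div_mul_cancel₀ _ h2]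
      ring
    change 1 / (2 * I * Real.sin δ) * (mobiusDelta δ z - 1) / z *
      (1 + t • (mobiusDelta δ z - 1))⁻¹ = (1 + z * c t)⁻¹
    rw [h5, h4]
    generalize 2 * I * (Real.sin δ : ℂ) = S at *
    generalize exp (-I * δ) = β at *
    generalize c t = γ at *
    field_simp
  have hcont : ContinuousOn (fun t => (1 + z * c t)⁻¹) (Set.Icc 0 1) :=
    ContinuousOn.inv₀ (by fun_prop) hne
  have hcont' : IntervalIntegrable (fun t => (1 + z * c t)⁻¹) MeasureTheory.volume 0 1 :=
    (Set.uIcc_of_le (zero_le_one' ℝ) ▸ hcont).intervalIntegrable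
  have hre : (∫ t in (0 : ℝ)..1, (1 + z * c t)⁻¹).re = ∫ t in (0 : ℝ)..1, ((1 + z * c t)⁻¹).re :=
    (reCLM.intervalIntegral_comp_comm hcont').symm
  rw [hint, hre]
  calc (1 / 2 : ℝ) = ∫ _ in (0 : ℝ)..1, (1 / 2 : ℝ) := by simp
    _ ≤ _ := intervalIntegral.integral_mono_on zero_le_one (by simp)
      ((Set.uIcc_of_le (zero_le_one' ℝ) ▸ continuous_re.comp_continuousOn hcont).intervalIntegrable)
      fun t ht => half_le_re_inv_one_add (hzc t ht)

theorem re_dslope_Bdelta_pos {δ : ℝ} (hδ0 : 0 < δ) (hδ2 : δ < Real.pi) {z : ℂ}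
    (hz : z ∈ ball (0 : ℂ) 1) : 0 < (dslope (Bdelta δ) 0 z).re := by
  have hoff : ∀ y ∈ ball (0 : ℂ) 1, y ≠ 0 → 1 / 2 ≤ (slope (Bdelta δ) 0 y).re := fun y hy hy0 => by
    simpa [slope_def_field, Bdelta_zero] using half_le_re_Bdelta_div hδ0 hδ2 hy hy0
  refine one_half_pos.trans_le ?_
  by_cases hz0 : z = 0
  · subst hz0
    have hd := ((differentiableOn_Bdelta hδ0 hδ2).differentiableAt
      (isOpen_ball.mem_nhds hz)).hasDerivAt.tendsto_slope
    rw [dslope_same]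
    refine ge_of_tendsto ((continuous_re.tendsto _).comp hd) ?_
    filter_upwards [mem_nhdsWithin_of_mem_nhds (isOpen_ball.mem_nhds hz), self_mem_nhdsWithin]
      with y hy hy0 using hoff y hy hy0
  · rw [dslope_of_ne _ hz0]
    exact hoff z hz hz0

theorem mul_dslope_Bdelta (δ : ℝ) (z : ℂ) : z * dslope (Bdelta δ) 0 z = Bdelta δ z := by
  simpa [Bdelta_zero] using sub_smul_dslope (Bdelta δ) 0 z

theorem hasDerivAt_Btilde {δ : ℝ} (hδ0 : 0 < δ) (hδ2 : δ < Real.pi) {z : ℂ}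
    (hz : z ∈ ball (0 : ℂ) 1) : HasDerivAt (Btilde δ) (dslope (Bdelta δ) 0 z) z := by
  have hd : DifferentiableOn ℂ (dslope (Bdelta δ) 0) (ball 0 1) :=
    (differentiableOn_dslope (ball_mem_nhds 0 one_pos)).2 (differentiableOn_Bdelta hδ0 hδ2)
  obtain ⟨P, hP0, hP⟩ := hd.isExactOn_ball.with_val_at 0 0
  have heq : ∀ x ∈ ball (0 : ℂ) 1, Btilde δ x = P x := fun x hx => by
    have hseg : ∀ t ∈ Set.uIcc (0 : ℝ) 1, (t : ℂ) * x ∈ ball (0 : ℂ) 1 := fun t ht => by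
      rw [Set.uIcc_of_le zero_le_one] at ht
      rw [mem_ball_zero_iff, norm_mul, norm_real, Real.norm_of_nonneg ht.1]
      exact (mul_le_of_le_one_left (norm_nonneg _) ht.2).trans_lt (mem_ball_zero_iff.1 hx)
    have hderiv : ∀ t ∈ Set.uIcc (0 : ℝ) 1,
        HasDerivAt (fun t : ℝ => P (t * x)) (dslope (Bdelta δ) 0 (t * x) * x) t := fun t ht => by
      have h1 : HasDerivAt (fun s : ℂ => s * x) x (t : ℂ) := by
        simpa using (hasDerivAt_id (t : ℂ)).mul_const x
      exact (HasDerivAt.comp (t : ℂ) (hP _ (hseg t ht)) h1).comp_ofReal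
    have hcont : ContinuousOn (fun t : ℝ => dslope (Bdelta δ) 0 (t * x) * x) (Set.uIcc 0 1) :=
      (hd.continuousOn.comp (by fun_prop) hseg).mul continuousOn_const
    have hftc := intervalIntegral.integral_eq_sub_of_hasDerivAt hderiv hcont.intervalIntegrable
    simp only [ofReal_one, one_mul, ofReal_zero, zero_mul, hP0, sub_zero] at hftc
    rw [← hftc, Btilde]
    refine intervalIntegral.integral_congr_ae (Filter.Eventually.of_forall fun t ht => ?_)
    rw [Set.uIoc_of_le zero_le_one] at ht
    by_cases hx0 : x = 0
    · simp [hx0]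
    have htx : (t : ℂ) * x ≠ 0 := mul_ne_zero (ofReal_ne_zero.2 ht.1.ne') hx0
    rw [dslope_of_ne _ htx, slope_def_field, Bdelta_zero, sub_zero, sub_zero]
  refine (hP z hz).congr_of_eventuallyEq ?_
  filter_upwards [isOpen_ball.mem_nhds hz] with x hx using heq x hx

theorem Btilde_zero (δ : ℝ) : Btilde δ 0 = 0 := by simp [Btilde]

/-- The **Noshiro–Warschawski theorem**. -/
theorem injOn_of_re_deriv_pos {H H' : ℂ → ℂ} {s : Set ℂ} (hs : Convex ℝ s)
    (hH : ∀ z ∈ s, HasDerivAt H (H' z) z) (hpos : ∀ z ∈ s, 0 < (H' z).re) : Set.InjOn H s := by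
  intro x hx y hy hxy
  by_contra hne
  have hd : y - x ≠ 0 := sub_ne_zero.2 (Ne.symm hne)
  have hseg : ∀ t ∈ Set.Icc (0 : ℝ) 1, x + t * (y - x) ∈ s := fun t ht => by
    simpa using hs.add_smul_sub_mem hx hy ht
  have hderiv : ∀ t ∈ Set.Icc (0 : ℝ) 1,
      HasDerivAt (fun t : ℝ => (H (x + t * (y - x)) / (y - x)).re) (H' (x + t * (y - x))).re t :=
    fun t ht => by
      have h1 : HasDerivAt (fun s : ℂ => x + s * (y - x)) (y - x) (t : ℂ) := by
        simpa using ((hasDerivAt_id (t : ℂ)).mul_const (y - x)).const_add x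
      have h2 := (HasDerivAt.comp (t : ℂ) (hH _ (hseg t ht)) h1).comp_ofReal.div_const (y - x)
      rw [mul_div_cancel_right₀ _ hd] at h2
      exact reCLM.hasFDerivAt.comp_hasDerivAt t h2
  have hmono := strictMonoOn_of_deriv_pos (convex_Icc (0 : ℝ) 1)
    (fun t ht => (hderiv t ht).continuousAt.continuousWithinAt) fun t ht => by
      rw [(hderiv t (interior_subset ht)).deriv]
      exact hpos _ (hseg t (interior_subset ht))
  have := hmono (Set.left_mem_Icc.2 zero_le_one) (Set.right_mem_Icc.2 zero_le_one) one_pos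
  simp [hxy] at this

theorem exists_hasDerivAt_exp_eq {F : ℂ → ℂ} (hF : DifferentiableOn ℂ F (ball 0 1))
    (hF0 : F 0 = 1) (hne : ∀ z ∈ ball (0 : ℂ) 1, F z ≠ 0) :
    ∃ G : ℂ → ℂ, G 0 = 0 ∧ (∀ z ∈ ball (0 : ℂ) 1, HasDerivAt G (deriv F z / F z) z) ∧
      ∀ z ∈ ball (0 : ℂ) 1, F z = exp (G z) := by
  have hd : DifferentiableOn ℂ (fun z => deriv F z / F z) (ball 0 1) :=
    (hF.deriv isOpen_ball).div hF hne
  obtain ⟨G, hG0, hG⟩ := hd.isExactOn_ball.with_val_at 0 0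
  refine ⟨G, hG0, hG, fun z hz => ?_⟩
  have hderiv : ∀ x ∈ ball (0 : ℂ) 1, HasDerivAt (fun x => F x * exp (-G x)) 0 x := fun x hx => by
    have h1 := (hF.differentiableAt (isOpen_ball.mem_nhds hx)).hasDerivAt
    have h2 : deriv F x * exp (-G x) + F x * (exp (-G x) * -(deriv F x / F x)) = 0 := by
      have := hne x hx
      field_simp
      ring
    exact h2 ▸ h1.mul (hG x hx).neg.cexp
  have hconst := isOpen_ball.is_const_of_deriv_eq_zero
    (convex_ball (0 : ℂ) 1).isPreconnected
    (fun x hx => (hderiv x hx).differentiableAt.differentiableWithinAt)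
    (fun x hx => (hderiv x hx).deriv) hz (mem_ball_self one_pos)
  simp only [hF0, hG0, neg_zero, Complex.exp_zero, mul_one] at hconst
  rw [Complex.exp_neg, mul_inv_eq_one₀ (Complex.exp_ne_zero _)] at hconst
  exact hconst

/-- If `f ∈ M(δ)` then `f(z)/z ≺ exp(B̃_δ(z))`, where `F` is the analytic extension of
`z ↦ f(z)/z` with `F 0 = 1`. -/
theorem f_div_z_subordinate_exp_Btilde (δ : ℝ) (hδ1 : Real.pi / 2 ≤ δ) (hδ2 : δ < Real.pi)
    (f : ℂ → ℂ) (hf : DifferentiableOn ℂ f (ball 0 1))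
    (hf0 : f 0 = 0) (hf1 : deriv f 0 = 1)
    (hfz : ∀ z ∈ ball (0 : ℂ) 1, z ≠ 0 → f z ≠ 0)
    (hM : ∀ z ∈ ball (0 : ℂ) 1, z ≠ 0 →
      1 + (δ - Real.pi) / (2 * Real.sin δ) < (z * deriv f z / f z).re ∧
      (z * deriv f z / f z).re < 1 + δ / (2 * Real.sin δ))
    (F : ℂ → ℂ) (hF : DifferentiableOn ℂ F (ball 0 1)) (hF0 : F 0 = 1)
    (hFf : ∀ z ∈ ball (0 : ℂ) 1, z ≠ 0 → F z = f z / z) :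
    Subord F (fun z => Complex.exp (Btilde δ z)) := by
  have hδ0 : 0 < δ := (half_pos Real.pi_pos).trans_le hδ1
  have hne : ∀ z ∈ ball (0 : ℂ) 1, F z ≠ 0 := fun z hz => by
    by_cases hz0 : z = 0
    · simp [hz0, hF0]
    · rw [hFf z hz hz0]
      exact div_ne_zero (hfz z hz hz0) hz0
  have hstrip : ∀ z ∈ ball (0 : ℂ) 1, z * (deriv F z / F z) ∈ deltaStrip δ := fun z hz => by
    by_cases hz0 : z = 0
    · simpa [hz0] using zero_mem_deltaStrip hδ0 hδ2
    have hfd : deriv f z = F z + z * deriv F z := by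
      have hev : f =ᶠ[nhds z] fun x => x * F x := by
        filter_upwards [isOpen_ball.mem_nhds hz, isOpen_ne.mem_nhds hz0] with x hx hx0
        rw [hFf x hx hx0, mul_div_cancel₀ _ hx0]
      rw [hev.deriv_eq]
      simpa using ((hasDerivAt_id' z).fun_mul
        (hF.differentiableAt (isOpen_ball.mem_nhds hz)).hasDerivAt).deriv
    have hfF : f z = z * F z := by rw [hFf z hz hz0, mul_div_cancel₀ _ hz0]
    have heq : z * deriv f z / f z = 1 + z * (deriv F z / F z) := by
      have := hne z hz
      rw [hfd, hfF]
      field_simp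
    have h := hM z hz hz0
    rw [heq, add_re, one_re] at h
    exact ⟨by linarith [h.1], by linarith [h.2]⟩
  obtain ⟨G, hG0, hG, hFG⟩ := exists_hasDerivAt_exp_eq hF hF0 hne
  have hp : DifferentiableOn ℂ (fun z => z * (deriv F z / F z)) (ball 0 1) :=
    differentiableOn_id.mul ((hF.deriv isOpen_ball).div hF hne)
  have hw : DifferentiableOn ℂ (fun z => BdeltaInv δ (z * (deriv F z / F z))) (ball 0 1) :=
    fun z hz => DifferentiableAt.comp_differentiableWithinAt z
      (differentiableAt_BdeltaInv hδ0 hδ2 (hstrip z hz)) (hp z hz)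
  have hschwarz : ∀ z ∈ ball (0 : ℂ) 1, ‖BdeltaInv δ (z * (deriv F z / F z))‖ ≤ ‖z‖ :=
    fun z hz => norm_le_norm_of_mapsTo_ball hw
      (fun x hx => ball_subset_closedBall (BdeltaInv_mem_ball hδ0 hδ2 (hstrip x hx)))
      (by simp [BdeltaInv_zero]) (mem_ball_zero_iff.1 hz)
  obtain ⟨ω, hωd, hω0, hωmem, hω⟩ : Subord G (Btilde δ) :=
    subord_of_mul_deriv_eq_comp (w := fun z => BdeltaInv δ (z * (deriv F z / F z)))
      (fun z hz => hasDerivAt_Btilde hδ0 hδ2 hz) (Btilde_zero δ)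
      (fun z hz h => (re_dslope_Bdelta_pos hδ0 hδ2 hz).ne' (by simp [h]))
      (injOn_of_re_deriv_pos (convex_ball 0 1) (fun z hz => hasDerivAt_Btilde hδ0 hδ2 hz)
        fun z hz => re_dslope_Bdelta_pos hδ0 hδ2 hz)
      (fun z _ => mul_dslope_Bdelta δ z)
      (fun a ha b hb m hm h => norm_le_of_Bdelta_eq_mul hδ0 hδ2 ha hb hm h) hG hG0
      hschwarz
      (fun z hz => (Bdelta_BdeltaInv hδ0 hδ2 (hstrip z hz)).symm)
  exact ⟨ω, hωd, hω0, hωmem, fun z hz => by rw [hFG z hz, hω z hz]⟩
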